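/- Define P(s) = Σ_{k=1}^∞ (-1)^{k+1} ((2k-1)π/2) e^{-s π²(2k-1)²/8} for s > 0. Then P is a probability density on (0, ∞) and its Laplace transform satisfies ∫₀^∞ e^{-λs} P(s) ds = 1/cosh(√(2λ)) for all λ > 0. -/

import Mathlib

open Real MeasureTheory

/-- The density of the exit time of Brownian motion from the unit ball of the spider:
`P(s) = Σ_{k=1}^∞ (-1)^{k+1} ((2k-1)π/2) e^{-s π²(2k-1)²/8}` (indexed by `k = n+1`). -/
noncomputable def exitDensity (s : ℝ) : ℝ :=
  ∑' n : ℕ, (-1 : ℝ)^n * (((2 * n + 1 : ℕ) : ℝ) * π / 2) *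
    Real.exp (-s * π^2 * ((2 * n + 1 : ℕ) : ℝ)^2 / 8)

open Filter Topology

lemma hasSum_transfer {ι : Type*} {f g : ι → ℝ} {a b : ℝ} (h : HasSum f a)
    (hf : ∀ k, g k = f k) (hb : b = a) : HasSum g b := by
  rw [hb, show g = f from funext hf]; exact h

/-- the alternating theta series term -/
noncomputable def altTerm (a : ℝ) (k : ℕ) : ℝ :=
  (2 * (k : ℝ) + 1) * Real.exp (-a * (2 * (k : ℝ) + 1) ^ 2)

lemma altTerm_antitone {a : ℝ} (ha : 1 / 2 ≤ a) : Antitone (altTerm a) := by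
  refine antitone_nat_of_succ_le fun k => ?_
  unfold altTerm
  push_cast
  have hk : (0 : ℝ) ≤ k := Nat.cast_nonneg k
  have h1 : Real.exp (-a * (2 * (k : ℝ) + 1) ^ 2)
      = Real.exp (a * (8 * k + 8)) * Real.exp (-a * (2 * ((k : ℝ) + 1) + 1) ^ 2) := by
    rw [← Real.exp_add]; congr 1; ring
  rw [h1, ← mul_assoc]
  refine mul_le_mul_of_nonneg_right ?_ (Real.exp_pos _).le
  have h2 : a * (8 * k + 8) + 1 ≤ Real.exp (a * (8 * k + 8)) := Real.add_one_le_exp _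
  have h3 : 4 * (k : ℝ) + 5 ≤ Real.exp (a * (8 * k + 8)) := by nlinarith
  nlinarith

lemma altTerm_nonneg {a S : ℝ} (ha : 1 / 2 ≤ a)
    (h : HasSum (fun k : ℕ => (-1 : ℝ) ^ k * altTerm a k) S) : 0 ≤ S := by
  have := (altTerm_antitone ha).alternating_series_le_tendsto h.tendsto_sum_nat 0
  simpa using this

lemma sin_odd_quarter (k : ℕ) : Real.sin (2 * π * (1 / 4 : ℝ) * ((2 * k + 1 : ℕ) : ℝ)) = (-1) ^ k := by
  have : 2 * π * (1 / 4 : ℝ) * ((2 * k + 1 : ℕ) : ℝ) = π / 2 + k * π := by push_cast; ring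
  rw [this, Real.sin_add_nat_mul_pi]; simp

lemma sin_even_quarter (k : ℕ) : Real.sin (2 * π * (1 / 4 : ℝ) * ((2 * k : ℕ) : ℝ)) = 0 := by
  have : 2 * π * (1 / 4 : ℝ) * ((2 * k : ℕ) : ℝ) = k * π := by push_cast; ring
  rw [this, Real.sin_nat_mul_pi]

lemma hasSum_sin {t : ℝ} (ht : 0 < t) :
    HasSum (fun k : ℕ => (-1 : ℝ) ^ k * altTerm (π * t) k)
      (HurwitzZeta.sinKernel ((1 / 4 : ℝ) : UnitAddCircle) t / 2) := by
  have h := (HurwitzZeta.hasSum_nat_sinKernel (1 / 4) ht).div_const 2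
  have hinj : Function.Injective (fun k : ℕ => 2 * k + 1) := fun a b hab => by
    simp only at hab; omega
  rw [← hinj.hasSum_iff] at h
  · refine hasSum_transfer h (fun k => ?_) rfl
    simp only [Function.comp]
    rw [sin_odd_quarter]
    unfold altTerm
    push_cast
    ring_nf
  · intro n hn
    obtain ⟨k, rfl | rfl⟩ := Nat.even_or_odd' n
    · rw [sin_even_quarter]; simp
    · exact absurd ⟨k, rfl⟩ hn

lemma hasSum_odd {t : ℝ} (ht : 0 < t) :
    HasSum (fun k : ℕ => (-1 : ℝ) ^ k * altTerm (π * t / 16) k)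
      (4 * HurwitzZeta.oddKernel ((1 / 4 : ℝ) : UnitAddCircle) t) := by
  have h := (HurwitzZeta.hasSum_int_oddKernel (1 / 4) ht).mul_left 4
  rw [← Equiv.intEquivNat.hasSum_iff]
  refine hasSum_transfer h (fun n => ?_) rfl
  obtain n | n := n
  · have : Equiv.intEquivNat (Int.ofNat n) = 2 * n := rfl
    simp only [Function.comp, this]
    unfold altTerm
    rw [pow_mul]
    push_cast
    simp only [Int.ofNat_eq_natCast, Int.cast_natCast]
    norm_num
    rw [← mul_assoc (4 : ℝ)]
    congr 1
    · ring
    · congr 1; ring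
  · have : Equiv.intEquivNat (Int.negSucc n) = 2 * n + 1 := rfl
    simp only [Function.comp, this]
    unfold altTerm
    rw [pow_succ, pow_mul]
    push_cast [Int.cast_negSucc]
    norm_num
    rw [← mul_assoc, ← neg_mul]
    congr 1
    · ring
    · congr 1; ring

lemma exitDensity_eq_sin {s : ℝ} (hs : 0 < s) :
    HasSum (fun k : ℕ => (-1 : ℝ) ^ k * altTerm (π ^ 2 * s / 8) k) (2 / π * exitDensity s) := by
  have h := (hasSum_sin (t := π * s / 8) (by positivity))
  have e : π * (π * s / 8) = π ^ 2 * s / 8 := by ring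
  rw [e] at h
  have h2 : exitDensity s = π / 2 * (HurwitzZeta.sinKernel ((1 / 4 : ℝ) : UnitAddCircle) (π * s / 8) / 2) := by
    refine (HasSum.tsum_eq ?_)
    refine hasSum_transfer (h.mul_left (π / 2)) (fun k => ?_) rfl
    unfold altTerm
    push_cast
    ring_nf
  have : 2 / π * exitDensity s = HurwitzZeta.sinKernel ((1 / 4 : ℝ) : UnitAddCircle) (π * s / 8) / 2 := by
    rw [h2]; field_simp
  rwa [this]

lemma rpow_three_half {x : ℝ} (hx : 0 < x) : x ^ (3 / 2 : ℝ) = x * √x := by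
  rw [show (3 / 2 : ℝ) = 1 + 1 / 2 by norm_num, Real.rpow_add hx, Real.rpow_one, Real.sqrt_eq_rpow]

lemma exitDensity_eq_odd {s : ℝ} (hs : 0 < s) :
    HasSum (fun k : ℕ => (-1 : ℝ) ^ k * altTerm (1 / (2 * s)) k)
      (√(2 * π) / 2 * (s * √s) * exitDensity s) := by
  have h := (hasSum_odd (t := 8 / (π * s)) (by positivity))
  have e : π * (8 / (π * s)) / 16 = 1 / (2 * s) := by field_simp; norm_num
  rw [e, HurwitzZeta.oddKernel_functional_equation] at h
  have h1 := hasSum_sin (t := π * s / 8) (by positivity)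
  have e1 : π * (π * s / 8) = π ^ 2 * s / 8 := by ring
  rw [e1] at h1
  have h2 := h1.unique (exitDensity_eq_sin hs)
  have e2 : 1 / (8 / (π * s)) = π * s / 8 := by field_simp
  rw [e2, rpow_three_half (by positivity)] at h
  convert h using 1
  have h3 : HurwitzZeta.sinKernel ((1 / 4 : ℝ) : UnitAddCircle) (π * s / 8) = 4 / π * exitDensity s := by
    linear_combination 2 * h2
  rw [h3]
  have e3 : √(8 / (π * s)) = 4 / (√(2 * π) * √s) := by
    rw [Real.sqrt_eq_iff_mul_self_eq (by positivity) (by positivity)]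
    have q1 := Real.mul_self_sqrt (show 0 ≤ 2 * π by positivity)
    have q2 := Real.mul_self_sqrt hs.le
    rw [div_mul_div_comm, mul_mul_mul_comm, q1, q2]
    field_simp; norm_num
  rw [e3]
  field_simp
  ring

lemma exitDensity_nonneg {s : ℝ} (hs : 0 < s) : 0 ≤ exitDensity s := by
  rcases le_total s 1 with h | h
  · have := altTerm_nonneg (by rw [div_le_div_iff₀] <;> linarith) (exitDensity_eq_odd hs)
    exact nonneg_of_mul_nonneg_right this (by positivity)
  · have := altTerm_nonneg (by nlinarith [Real.pi_gt_three]) (exitDensity_eq_sin hs)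
    exact nonneg_of_mul_nonneg_right this (by positivity)

/-- Gaussian primitive -/
noncomputable def gPrim (x : ℝ) : ℝ := ∫ t in (0 : ℝ)..x, Real.exp (-(1 / 2) * t ^ 2)

lemma gPrim_deriv (x : ℝ) : HasDerivAt gPrim (Real.exp (-(1 / 2) * x ^ 2)) x := by
  have hc : Continuous fun t : ℝ => Real.exp (-(1 / 2) * t ^ 2) := by fun_prop
  exact hc.integral_hasStrictDerivAt 0 x |>.hasDerivAt

lemma gPrim_top : Tendsto gPrim atTop (𝓝 (√(2 * π) / 2)) := by
  have h := intervalIntegral_tendsto_integral_Ioi (0 : ℝ)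
    (integrable_exp_neg_mul_sq (b := 1 / 2) (by norm_num)).integrableOn tendsto_id
  rw [integral_gaussian_Ioi] at h
  rw [show π / (1 / 2) = 2 * π by ring] at h
  exact h

lemma gPrim_neg (x : ℝ) : gPrim (-x) = - gPrim x := by
  unfold gPrim
  rw [intervalIntegral.integral_symm, neg_inj]
  have := intervalIntegral.integral_comp_neg (a := 0) (b := x) (fun t : ℝ => Real.exp (-(1 / 2) * t ^ 2))
  simpa using this.symm

lemma gPrim_bot : Tendsto gPrim atBot (𝓝 (-(√(2 * π) / 2))) := by
  have := (gPrim_top.comp tendsto_neg_atBot_atTop).neg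
  refine this.congr fun x => ?_
  simp [gPrim_neg]

/-- inverse Gaussian primitive -/
noncomputable def igPrim (c m s : ℝ) : ℝ :=
  gPrim (c * √s - m / √s) - Real.exp (2 * c * m) * gPrim (c * √s + m / √s)

lemma igPrim_deriv (c m : ℝ) {s : ℝ} (hs : 0 < s) :
    HasDerivAt (igPrim c m)
      (m / (s * √s) * Real.exp (-(1 / 2) * (c * √s - m / √s) ^ 2)) s := by
  have hq : 0 < √s := Real.sqrt_pos.2 hs
  have hsq : √s * √s = s := Real.mul_self_sqrt hs.le
  have h0 := Real.hasDerivAt_sqrt hs.ne'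
  have h1 := h0.const_mul c
  have h2 := (h0.inv hq.ne').const_mul m
  have h3 := (gPrim_deriv _).comp s (h1.sub h2)
  have h4 := ((gPrim_deriv _).comp s (h1.add h2)).const_mul (Real.exp (2 * c * m))
  have h5 := h3.sub h4
  refine (h5.congr_deriv ?_)
  simp only [Pi.add_apply, Pi.sub_apply, Pi.inv_apply]
  rw [← mul_assoc, ← Real.exp_add]
  have e : 2 * c * m + -(1 / 2) * (c * √s + m * (√s)⁻¹) ^ 2 = -(1 / 2) * (c * √s - m * (√s)⁻¹) ^ 2 := by
    field_simp; ring
  rw [e, div_eq_mul_inv m (√s)]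
  generalize Real.exp (-(1 / 2) * (c * √s - m * (√s)⁻¹) ^ 2) = E
  have : s = √s ^ 2 := by rw [sq, hsq]
  generalize √s = q at *
  subst this
  field_simp
  ring

lemma igPrim_top {c m : ℝ} (hc : 0 < c) : Tendsto (igPrim c m) atTop
    (𝓝 (√(2 * π) / 2 - Real.exp (2 * c * m) * (√(2 * π) / 2))) := by
  have h1 : Tendsto (fun s => c * √s) atTop atTop := Real.tendsto_sqrt_atTop.const_mul_atTop hc
  have h2 : Tendsto (fun s => m / √s) atTop (𝓝 0) := Real.tendsto_sqrt_atTop.const_div_atTop m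
  have h3 : Tendsto (fun s => c * √s - m / √s) atTop atTop := by
    simpa only [sub_eq_add_neg] using h1.atTop_add h2.neg
  exact (gPrim_top.comp h3).sub ((gPrim_top.comp (h1.atTop_add h2)).const_mul _)

lemma igPrim_zero {c m : ℝ} (hm : 0 < m) : Tendsto (igPrim c m) (𝓝[>] 0)
    (𝓝 (-(√(2 * π) / 2) - Real.exp (2 * c * m) * (√(2 * π) / 2))) := by
  have h0 : Tendsto (fun s => √s) (𝓝[>] 0) (𝓝 0) := by
    have := (Real.continuous_sqrt.tendsto 0).mono_left (nhdsWithin_le_nhds (s := Set.Ioi 0))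
    simpa using this
  have h0' : Tendsto (fun s => √s) (𝓝[>] 0) (𝓝[>] 0) := by
    refine tendsto_nhdsWithin_iff.2 ⟨h0, ?_⟩
    filter_upwards [self_mem_nhdsWithin] with s hs
    exact Real.sqrt_pos.2 hs
  have h1 : Tendsto (fun s => c * √s) (𝓝[>] 0) (𝓝 0) := by simpa using h0.const_mul c
  have h2 : Tendsto (fun s => m / √s) (𝓝[>] 0) atTop := by
    simp only [div_eq_mul_inv]
    exact (tendsto_inv_nhdsGT_zero.comp h0').const_mul_atTop hm
  have h3 : Tendsto (fun s => c * √s - m / √s) (𝓝[>] 0) atBot := by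
    simpa only [sub_eq_add_neg, Function.comp_def] using h1.add_atBot (tendsto_neg_atTop_atBot.comp h2)
  exact (gPrim_bot.comp h3).sub ((gPrim_top.comp (h1.add_atTop h2)).const_mul _)

lemma ig_integral {c m : ℝ} (hc : 0 < c) (hm : 0 < m) :
    IntegrableOn (fun s => m / (s * √s) * Real.exp (-(1 / 2) * (c * √s - m / √s) ^ 2)) (Set.Ioi 0) ∧
    ∫ s in Set.Ioi (0 : ℝ), m / (s * √s) * Real.exp (-(1 / 2) * (c * √s - m / √s) ^ 2) = √(2 * π) := by
  set L := (-(√(2 * π) / 2) - Real.exp (2 * c * m) * (√(2 * π) / 2)) with hL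
  have hcont : ContinuousWithinAt (Function.update (igPrim c m) 0 L) (Set.Ici 0) 0 := by
    rw [continuousWithinAt_update_same, Set.Ici_sdiff_left]
    exact igPrim_zero hm
  have hder : ∀ x ∈ Set.Ioi (0 : ℝ), HasDerivAt (Function.update (igPrim c m) 0 L)
      (m / (x * √x) * Real.exp (-(1 / 2) * (c * √x - m / √x) ^ 2)) x := by
    intro x hx
    refine (igPrim_deriv c m hx).congr_of_eventuallyEq ?_
    filter_upwards [eventually_ne_nhds (ne_of_gt hx)] with y hy
    exact Function.update_of_ne hy _ _
  have hpos : ∀ x ∈ Set.Ioi (0 : ℝ), 0 ≤ m / (x * √x) * Real.exp (-(1 / 2) * (c * √x - m / √x) ^ 2) := by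
    intro x hx
    have : 0 < x := hx
    positivity
  have htop : Tendsto (Function.update (igPrim c m) 0 L) atTop
      (𝓝 (√(2 * π) / 2 - Real.exp (2 * c * m) * (√(2 * π) / 2))) := by
    refine (igPrim_top hc).congr' ?_
    filter_upwards [eventually_ne_atTop 0] with y hy
    exact (Function.update_of_ne hy _ _).symm
  refine ⟨integrableOn_Ioi_deriv_of_nonneg hcont hder hpos htop, ?_⟩
  rw [integral_Ioi_of_hasDerivAt_of_nonneg hcont hder hpos htop, Function.update_self, hL]
  ring

/-- terms of the Laplace integrand -/
noncomputable def lapTerm (lam : ℝ) (k : ℕ) (s : ℝ) : ℝ :=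
  Real.exp (-lam * s) * (2 / (√(2 * π) * (s * √s)) * altTerm (1 / (2 * s)) k)

lemma lapTerm_eq {lam s : ℝ} (hl : 0 < lam) (hs : 0 < s) (k : ℕ) :
    lapTerm lam k s = 2 / √(2 * π) * Real.exp (-((2 * k + 1) * √(2 * lam))) *
     ((2 * k + 1) / (s * √s) *
      Real.exp (-(1 / 2) * (√(2 * lam) * √s - (2 * k + 1) / √s) ^ 2)) := by
  unfold lapTerm altTerm
  have hq : 0 < √s := Real.sqrt_pos.2 hs
  have e : Real.exp (-((2 * k + 1) * √(2 * lam))) *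
      Real.exp (-(1 / 2) * (√(2 * lam) * √s - (2 * k + 1) / √s) ^ 2) =
      Real.exp (-lam * s) * Real.exp (-(1 / (2 * s)) * (2 * k + 1) ^ 2) := by
    rw [← Real.exp_add, ← Real.exp_add]
    congr 1
    rw [sub_sq, mul_pow, div_pow, Real.sq_sqrt hs.le, Real.sq_sqrt (by positivity)]
    field_simp
    ring
  have hp : 0 < √(2 * π) := by positivity
  have e' : (2 / (√(2 * π) * (s * √s))) = 2 / √(2 * π) * (1 / (s * √s)) := by field_simp
  rw [e']
  linear_combination (-(2 * (k : ℝ) + 1) * (2 / √(2 * π)) * (1 / (s * √s))) * e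

lemma lapTerm_integral {lam : ℝ} (hl : 0 < lam) (k : ℕ) :
    IntegrableOn (lapTerm lam k) (Set.Ioi 0) ∧
    ∫ s in Set.Ioi (0 : ℝ), lapTerm lam k s = 2 * Real.exp (-((2 * k + 1) * √(2 * lam))) := by
  obtain ⟨h1, h2⟩ := ig_integral (c := √(2 * lam)) (m := 2 * k + 1) (by positivity) (by positivity)
  constructor
  · refine IntegrableOn.congr_fun (h1.const_mul (2 / √(2 * π) * Real.exp (-((2 * k + 1) * √(2 * lam)))))
      (fun s hs => (lapTerm_eq hl hs k).symm) measurableSet_Ioi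
  · rw [setIntegral_congr_fun measurableSet_Ioi (fun s hs => lapTerm_eq hl hs k), integral_const_mul, h2]
    have hp : 0 < √(2 * π) := by positivity
    field_simp

lemma sech_sum {c : ℝ} (hc : 0 < c) :
    HasSum (fun k : ℕ => (-1 : ℝ) ^ k * (2 * Real.exp (-((2 * k + 1) * c)))) (1 / Real.cosh c) := by
  have hlt : Real.exp (-(2 * c)) < 1 := by rw [Real.exp_lt_one_iff]; linarith
  have h := (hasSum_geometric_of_abs_lt_one (r := -Real.exp (-(2 * c)))
    (by rwa [abs_neg, abs_of_pos (Real.exp_pos _)])).mul_left (2 * Real.exp (-c))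
  refine hasSum_transfer h (fun k => ?_) ?_
  · rw [neg_pow (Real.exp _), ← Real.exp_nat_mul]
    have e0 : Real.exp (-((2 * k + 1) * c)) = Real.exp (-c) * Real.exp (k * -(2 * c)) := by
      rw [← Real.exp_add]; congr 1; ring
    rw [e0]; ring
  · rw [Real.cosh_eq]
    have e1 : Real.exp (-(2 * c)) = Real.exp (-c) * Real.exp (-c) := by rw [← Real.exp_add]; ring_nf
    have e2 : Real.exp c * Real.exp (-c) = 1 := by rw [← Real.exp_add]; simp
    rw [e1, sub_neg_eq_add]
    have p1 := Real.exp_pos c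
    have p2 := Real.exp_pos (-c)
    field_simp
    linear_combination -e2

lemma laplace {lam : ℝ} (hl : 0 < lam) :
    ∫ s in Set.Ioi (0:ℝ), Real.exp (-lam * s) * exitDensity s =
          1 / Real.cosh (Real.sqrt (2 * lam)) := by
  have hc : 0 < √(2 * lam) := by positivity
  have hnn : ∀ k : ℕ, ∀ s ∈ Set.Ioi (0 : ℝ), ‖(-1 : ℝ) ^ k * lapTerm lam k s‖ = lapTerm lam k s := by
    intro k s hs
    have : 0 < s := hs
    rw [norm_mul, norm_pow, norm_neg, norm_one, one_pow, one_mul, Real.norm_of_nonneg]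
    unfold lapTerm altTerm
    positivity
  have h := hasSum_integral_of_summable_integral_norm (μ := volume.restrict (Set.Ioi (0 : ℝ)))
    (F := fun k s => (-1 : ℝ) ^ k * lapTerm lam k s)
    (fun k => (lapTerm_integral hl k).1.const_mul _) (by
      have : ∀ k : ℕ, ∫ s in Set.Ioi (0 : ℝ), ‖(-1 : ℝ) ^ k * lapTerm lam k s‖
          = 2 * Real.exp (-((2 * k + 1) * √(2 * lam))) := fun k => by
        rw [setIntegral_congr_fun measurableSet_Ioi (hnn k), (lapTerm_integral hl k).2]
      simp_rw [this]
      refine (sech_sum hc).summable.norm.congr fun k => ?_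
      rw [norm_mul, norm_pow, norm_neg, norm_one, one_pow, one_mul, Real.norm_of_nonneg]
      positivity)
  simp only [integral_const_mul, (lapTerm_integral hl _).2] at h
  rw [← h.unique (sech_sum hc)]
  refine setIntegral_congr_fun measurableSet_Ioi fun s hs => ?_
  have hs : 0 < s := hs
  have h1 := (exitDensity_eq_odd hs).mul_left (Real.exp (-lam * s) * (2 / (√(2 * π) * (s * √s))))
  have h2 : HasSum (fun k : ℕ => (-1 : ℝ) ^ k * lapTerm lam k s) (Real.exp (-lam * s) * exitDensity s) := by
    refine hasSum_transfer h1 (fun k => ?_) ?_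
    · unfold lapTerm; ring
    · have : 0 < √s := by positivity
      have : 0 < √(2 * π) := by positivity
      field_simp
  exact h2.tsum_eq.symm

lemma laplace_integrable {lam : ℝ} (hl : 0 < lam) :
    IntegrableOn (fun s => Real.exp (-lam * s) * exitDensity s) (Set.Ioi 0) := by
  by_contra hcon
  have h1 := laplace hl
  rw [integral_undef hcon] at h1
  have := Real.cosh_pos (√(2 * lam))
  have : 0 < 1 / Real.cosh (√(2 * lam)) := by positivity
  linarith

lemma exitDensity_aesm : AEStronglyMeasurable exitDensity (volume.restrict (Set.Ioi (0 : ℝ))) := by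
  have h := (laplace_integrable one_pos).aestronglyMeasurable
  have h2 : AEStronglyMeasurable (fun s : ℝ => Real.exp s) (volume.restrict (Set.Ioi (0 : ℝ))) :=
    Real.continuous_exp.aestronglyMeasurable
  refine (h2.mul h).congr (Eventually.of_forall fun s => ?_)
  simp only [Pi.mul_apply]
  rw [← mul_assoc, ← Real.exp_add]; simp

lemma total_mass : ∫ s in Set.Ioi (0:ℝ), exitDensity s = 1 := by
  have hl : ∀ n : ℕ, (0 : ℝ) < 1 / ((n : ℝ) + 1) := fun n => by positivity
  have hae : ∀ᵐ s ∂(volume.restrict (Set.Ioi (0 : ℝ))), 0 ≤ exitDensity s := by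
    filter_upwards [ae_restrict_mem measurableSet_Ioi] with s hs using exitDensity_nonneg hs
  have hlim : Tendsto (fun n : ℕ => 1 / ((n : ℝ) + 1)) atTop (𝓝 0) := tendsto_one_div_add_atTop_nhds_zero_nat
  have h1 := lintegral_tendsto_of_tendsto_of_monotone (μ := volume.restrict (Set.Ioi (0 : ℝ)))
    (f := fun n s => ENNReal.ofReal (Real.exp (-(1 / ((n : ℝ) + 1)) * s) * exitDensity s))
    (F := fun s => ENNReal.ofReal (exitDensity s))
    (fun n => (laplace_integrable (hl n)).aestronglyMeasurable.aemeasurable.ennreal_ofReal)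
    (by
      filter_upwards [ae_restrict_mem measurableSet_Ioi] with s hs
      have hs' : 0 < s := hs
      intro i j hij
      refine ENNReal.ofReal_le_ofReal (mul_le_mul_of_nonneg_right (Real.exp_le_exp.2 ?_) (exitDensity_nonneg hs))
      have := one_div_le_one_div_of_le (by positivity : (0 : ℝ) < i + 1) (by gcongr : (i : ℝ) + 1 ≤ j + 1)
      nlinarith)
    (by
      refine Eventually.of_forall fun s => ?_
      refine ENNReal.tendsto_ofReal ?_
      have : Tendsto (fun n : ℕ => Real.exp (-(1 / ((n : ℝ) + 1)) * s) * exitDensity s) atTop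
          (𝓝 (Real.exp (-0 * s) * exitDensity s)) :=
        ((Real.continuous_exp.tendsto _).comp (hlim.neg.mul_const s)).mul_const _
      simpa using this)
  have h2 : ∀ n : ℕ, ∫⁻ s in Set.Ioi (0 : ℝ), ENNReal.ofReal (Real.exp (-(1 / ((n : ℝ) + 1)) * s) * exitDensity s)
      = ENNReal.ofReal (1 / Real.cosh (√(2 * (1 / ((n : ℝ) + 1))))) := fun n => by
    rw [← laplace (hl n), ofReal_integral_eq_lintegral_ofReal (laplace_integrable (hl n))]
    filter_upwards [hae] with s hs
    exact mul_nonneg (Real.exp_pos _).le hs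
  simp only [h2] at h1
  have h3 : Tendsto (fun n : ℕ => ENNReal.ofReal (1 / Real.cosh (√(2 * (1 / ((n : ℝ) + 1)))))) atTop (𝓝 (ENNReal.ofReal 1)) := by
    refine ENNReal.tendsto_ofReal ?_
    have hc : Continuous fun x : ℝ => 1 / Real.cosh (√(2 * x)) := by
      refine continuous_const.div (Real.continuous_cosh.comp (by fun_prop)) fun x => (Real.cosh_pos _).ne'
    have := (hc.tendsto 0).comp hlim
    rw [mul_zero, Real.sqrt_zero, Real.cosh_zero, div_one] at this
    exact this
  rw [integral_eq_lintegral_of_nonneg_ae hae exitDensity_aesm, tendsto_nhds_unique h1 h3]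
  simp

/-- `exitDensity` is a probability density on `(0,∞)` whose Laplace transform is
`1/cosh(√(2λ))`. -/
theorem exitDensity_is_density_and_laplace :
    (∀ s ∈ Set.Ioi (0:ℝ), 0 ≤ exitDensity s) ∧
      (∫ s in Set.Ioi (0:ℝ), exitDensity s = 1) ∧
      (∀ lam : ℝ, 0 < lam →
        ∫ s in Set.Ioi (0:ℝ), Real.exp (-lam * s) * exitDensity s =
          1 / Real.cosh (Real.sqrt (2 * lam))) := by
  exact ⟨fun s hs => exitDensity_nonneg hs, total_mass, fun lam hl => laplace hl⟩
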